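/- arXiv:0707.2669 — 5 statements merged into one kernel-verified Lean document; each statement's English description precedes it below -/
import Mathlib

section
/- Let Ω ⊆ ℝⁿ be a bounded Lebesgue-measurable set and let U : ℝⁿ → ℝⁿ be a C¹ map such that U and its total derivative DU are bounded on ℝⁿ. Then the function t ↦ vol((Id + tU)(Ω)) (Lebesgue measure of the image of Ω under x ↦ x + tU(x)) is differentiable at t = 0, and its derivative at 0 equals ∫_Ω div U(x) dx, where div U(x) is the trace of the derivative DU(x). -/
open MeasureTheory

theorem contDiff_continuousLinearMap_det {n : ℕ} {k : WithTop ℕ∞} :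
    ContDiff ℝ k (fun A : (Fin n → ℝ) →L[ℝ] (Fin n → ℝ) => A.det) := by
  have h : (fun A : (Fin n → ℝ) →L[ℝ] (Fin n → ℝ) => A.det) = fun A =>
      ∑ σ : Equiv.Perm (Fin n), (Equiv.Perm.sign σ : ℤ) • ∏ i, A (Pi.single i 1) (σ i) := by
    ext A
    rw [ContinuousLinearMap.det, ← LinearMap.det_toMatrix', Matrix.det_apply]
    simp [LinearMap.toMatrix'_apply, Units.smul_def, Pi.single]
  rw [h]
  simp only [zsmul_eq_mul]
  refine ContDiff.sum fun σ _ => contDiff_const.mul (contDiff_prod fun i _ => ?_)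
  exact contDiff_pi.1 (contDiff_id.clm_apply contDiff_const) (σ i)

theorem hasDerivAt_det_id_add_smul {n : ℕ} (A : (Fin n → ℝ) →L[ℝ] (Fin n → ℝ)) :
    HasDerivAt (fun t : ℝ => (ContinuousLinearMap.id ℝ (Fin n → ℝ) + t • A).det)
      (LinearMap.trace ℝ (Fin n → ℝ) A.toLinearMap) 0 := by
  set M := LinearMap.toMatrix' A.toLinearMap
  set p := (1 + (Polynomial.X : Polynomial ℝ) • M.map Polynomial.C).det with hp
  have h : (fun t : ℝ => (ContinuousLinearMap.id ℝ (Fin n → ℝ) + t • A).det) =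
      fun t => p.eval t := by
    ext t
    rw [ContinuousLinearMap.det, ← LinearMap.det_toMatrix', hp, ← Polynomial.coe_evalRingHom,
      RingHom.map_det]
    congr 1
    ext i j
    by_cases hij : i = j <;>
      simp [M, LinearMap.toMatrix'_apply, hij, mul_comm t]
  have := p.hasDerivAt 0
  rw [hp, Matrix.derivative_det_one_add_X_smul, ← hp, ← h] at this
  rwa [LinearMap.trace_eq_matrix_trace ℝ (Pi.basisFun ℝ (Fin n)), LinearMap.toMatrix_eq_toMatrix']

/-- On a ball of operators, `t ↦ det (id + t A)` is Lipschitz for `|t| < 1`, uniformly in `A`. -/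
theorem exists_lipschitz_det_id_add_smul {n : ℕ} (M : ℝ) :
    ∃ K : ℝ, 0 ≤ K ∧ ∀ A : (Fin n → ℝ) →L[ℝ] (Fin n → ℝ), ‖A‖ ≤ M →
      ∀ s ∈ Metric.ball (0 : ℝ) 1, ∀ t ∈ Metric.ball (0 : ℝ) 1,
      |(ContinuousLinearMap.id ℝ (Fin n → ℝ) + s • A).det -
        (ContinuousLinearMap.id ℝ (Fin n → ℝ) + t • A).det| ≤ K * |s - t| := by
  set d := fun A : (Fin n → ℝ) →L[ℝ] (Fin n → ℝ) => A.det
  have hd : ContDiff ℝ 1 d := contDiff_continuousLinearMap_det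
  set I := ContinuousLinearMap.id ℝ (Fin n → ℝ)
  obtain ⟨C, hC⟩ := (isCompact_closedBall I M).exists_bound_of_continuousOn
    (hd.continuous_fderiv one_ne_zero).continuousOn
  refine ⟨|C| * |M|, by positivity, fun A hA s hs t ht => ?_⟩
  have hmem : ∀ r ∈ Metric.ball (0 : ℝ) 1, I + r • A ∈ Metric.closedBall I M := by
    intro r hr
    rw [mem_ball_zero_iff] at hr
    rw [mem_closedBall_iff_norm, add_sub_cancel_left, norm_smul]
    nlinarith [norm_nonneg A, norm_nonneg r]
  have hsub : s • A - t • A = (s - t) • A := (sub_smul s t A).symm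
  have key := (convex_closedBall I M).norm_image_sub_le_of_norm_fderiv_le
    (fun x _ => (hd.differentiable one_ne_zero) x) hC (hmem t ht) (hmem s hs)
  rw [add_sub_add_left_eq_sub, hsub, norm_smul, Real.norm_eq_abs, Real.norm_eq_abs] at key
  calc _ ≤ C * (|s - t| * ‖A‖) := key
    _ ≤ |C| * (|s - t| * |M|) := by
      gcongr
      · exact le_abs_self C
      · exact hA.trans (le_abs_self M)
    _ = _ := by ring

theorem injective_add_smul_of_lipschitzWith {E : Type*} [NormedAddCommGroup E] [NormedSpace ℝ E]
    {U : E → E} {K : NNReal} (hU : LipschitzWith K U) {t : ℝ} (ht : |t| * K < 1) :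
    Function.Injective fun x => x + t • U x := by
  intro x y hxy
  have h : x - y = t • (U y - U x) := by
    rw [smul_sub, sub_eq_sub_iff_add_eq_add, add_comm (t • U y)]
    exact hxy
  have h1 : ‖x - y‖ ≤ |t| * K * ‖x - y‖ := by
    calc ‖x - y‖ = |t| * ‖U y - U x‖ := by
          conv_lhs => rw [h]
          rw [norm_smul, Real.norm_eq_abs]
      _ ≤ |t| * (K * ‖y - x‖) := by gcongr; exact hU.norm_sub_le y x
      _ = _ := by rw [norm_sub_rev y x]; ring
  have : ‖x - y‖ = 0 := by nlinarith [norm_nonneg (x - y)]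
  exact sub_eq_zero.1 (norm_eq_zero.1 this)

/-- Shape derivative of the volume: `t ↦ vol((Id + tU)(Ω))` is differentiable at `0`
with derivative `∫_Ω div U`. -/
theorem stmt_1 {n : ℕ} (Ω : Set (Fin n → ℝ)) (hΩb : Bornology.IsBounded Ω)
    (hΩm : MeasurableSet Ω)
    (U : (Fin n → ℝ) → (Fin n → ℝ)) (hU : ContDiff ℝ 1 U)
    (hUbdd : ∃ M : ℝ, ∀ x, ‖U x‖ ≤ M) (hDUbdd : ∃ M : ℝ, ∀ x, ‖fderiv ℝ U x‖ ≤ M) :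
    HasDerivAt (fun t : ℝ => (volume ((fun x => x + t • U x) '' Ω)).toReal)
      (∫ x in Ω, LinearMap.trace ℝ (Fin n → ℝ) (fderiv ℝ U x).toLinearMap) 0 := by
  obtain ⟨M, hM⟩ := hDUbdd
  have hdiff : Differentiable ℝ U := hU.differentiable one_ne_zero
  have hDU : Continuous (fderiv ℝ U) := hU.continuous_fderiv one_ne_zero
  have hΩfin : volume Ω < ⊤ := hΩb.measure_lt_top
  have : IsFiniteMeasure (volume.restrict Ω) := ⟨by simpa using hΩfin⟩
  have hM0 : 0 ≤ M := (norm_nonneg _).trans (hM 0)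
  have hLip : LipschitzWith M.toNNReal U :=
    lipschitzWith_of_nnnorm_fderiv_le hdiff fun x => by
      rw [← NNReal.coe_le_coe, coe_nnnorm, Real.coe_toNNReal M hM0]
      exact hM x
  set I := ContinuousLinearMap.id ℝ (Fin n → ℝ)
  have hvol : ∀ᶠ t : ℝ in nhds 0, (volume ((fun x => x + t • U x) '' Ω)).toReal =
      ∫ x in Ω, |(I + t • fderiv ℝ U x).det| := by
    have hlim : ∀ᶠ t : ℝ in nhds 0, |t| * M.toNNReal < 1 := by
      have hc : Continuous fun t : ℝ => |t| * M.toNNReal := by fun_prop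
      exact hc.continuousAt.eventually_lt continuousAt_const (by simp)
    filter_upwards [hlim] with t ht
    have := integral_image_eq_integral_abs_det_fderiv_smul volume hΩm
      (f := fun x => x + t • U x) (f' := fun x => I + t • fderiv ℝ U x)
      (fun x _ => ((hasFDerivAt_id x).add
        ((hdiff x).hasFDerivAt.const_smul t)).hasFDerivWithinAt)
      (injective_add_smul_of_lipschitzWith hLip ht).injOn (fun _ => (1 : ℝ))
    simpa [Measure.real] using this
  refine HasDerivAt.congr_of_eventuallyEq ?_ hvol
  obtain ⟨K, hK0, hK⟩ := exists_lipschitz_det_id_add_smul (n := n) M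
  have hcont : ∀ t : ℝ, Continuous fun x => |(I + t • fderiv ℝ U x).det| := fun t =>
    ((contDiff_continuousLinearMap_det (k := 0)).continuous.comp
      (continuous_const.add (hDU.const_smul t))).abs
  have htr : Continuous fun x =>
      LinearMap.trace ℝ (Fin n → ℝ) (fderiv ℝ U x).toLinearMap :=
    (LinearMap.continuous_of_finiteDimensional
      ((LinearMap.trace ℝ (Fin n → ℝ)).comp (ContinuousLinearMap.coeLM ℝ))).comp hDU
  refine (hasDerivAt_integral_of_dominated_loc_of_lip (bound := fun _ => K)
    (Metric.ball_mem_nhds (0 : ℝ) one_pos)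
    (.of_forall fun t => (hcont t).aestronglyMeasurable) ?_ htr.aestronglyMeasurable
    (.of_forall fun x => ?_) (integrable_const K) (.of_forall fun x => ?_)).2
  · simp [I, ContinuousLinearMap.det]
  · refine LipschitzOnWith.of_dist_le_mul fun s hs t ht => ?_
    rw [Real.dist_eq, Real.dist_eq, Real.coe_nnabs, abs_of_nonneg hK0]
    exact (abs_abs_sub_abs_le _ _).trans (hK _ (hM x) s hs t ht)
  · have h1 : (I + (0 : ℝ) • fderiv ℝ U x).det = 1 := by simp [I, ContinuousLinearMap.det]
    have := (hasDerivAt_abs_pos (x := (I + (0 : ℝ) • fderiv ℝ U x).det)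
      (by rw [h1]; exact one_pos)).comp (0 : ℝ) (hasDerivAt_det_id_add_smul (fderiv ℝ U x))
    rwa [one_mul] at this
end

section
/- Let Ω ⊆ ℝ³ be a bounded Lebesgue-measurable set and let U : ℝ³ → ℝ³ be a C¹ map such that U and its total derivative DU are bounded on ℝ³. Write U_z for the third component of U. Then the function t ↦ ∫_{(Id + tU)(Ω)} x₃ dx (integral of the third coordinate over the deformed domain) is differentiable at t = 0, with derivative ∫_Ω U_z(x) dx + ∫_Ω x₃ · div U(x) dx, where div U(x) is the trace of DU(x). -/
open MeasureTheory

open Set Filter Topology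

/-- The expansion of `det (1 + t L)` in powers of `t` in dimension three. -/
lemma det_one_add_smul_fin_three (L : (Fin 3 → ℝ) →L[ℝ] (Fin 3 → ℝ)) (t : ℝ) :
    (ContinuousLinearMap.id ℝ (Fin 3 → ℝ) + t • L).det =
      1 + t * LinearMap.trace ℝ (Fin 3 → ℝ) L.toLinearMap +
        t ^ 2 * ((LinearMap.trace ℝ (Fin 3 → ℝ) L.toLinearMap ^ 2 -
          LinearMap.trace ℝ (Fin 3 → ℝ) (L.comp L).toLinearMap) / 2) + t ^ 3 * L.det := by
  obtain ⟨A, hA⟩ := (Matrix.toLin' (R := ℝ) (m := Fin 3) (n := Fin 3)).surjective L.toLinearMap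
  have h1 : (ContinuousLinearMap.id ℝ (Fin 3 → ℝ) + t • L).toLinearMap =
      Matrix.toLin' (1 + t • A) := by
    simp only [ContinuousLinearMap.toLinearMap_add, ContinuousLinearMap.toLinearMap_smul,
      map_add, map_smul, Matrix.toLin'_one, hA]
    rfl
  have h2 : (L.comp L).toLinearMap = Matrix.toLin' (A * A) := by
    rw [ContinuousLinearMap.toLinearMap_comp, ← hA, Matrix.toLin'_mul]
  rw [ContinuousLinearMap.det, ContinuousLinearMap.det, h1, h2, ← hA, LinearMap.det_toLin',
    LinearMap.det_toLin', Matrix.trace_toLin'_eq, Matrix.trace_toLin'_eq, Matrix.det_fin_three,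
    Matrix.det_fin_three, Matrix.trace_fin_three, Matrix.trace_fin_three]
  simp [Matrix.mul_apply, Fin.sum_univ_three]
  ring

lemma continuous_trace_toLinearMap {E : Type*} [NormedAddCommGroup E] [NormedSpace ℝ E]
    [FiniteDimensional ℝ E] :
    Continuous fun L : E →L[ℝ] E => LinearMap.trace ℝ E L.toLinearMap :=
  (LinearMap.trace ℝ E ∘ₗ ContinuousLinearMap.coeLM ℝ).continuous_of_finiteDimensional

/-- A perturbation of the identity by a small multiple of a Lipschitz map is injective. -/
lemma LipschitzWith.injective_add_smul {E : Type*} [NormedAddCommGroup E] [NormedSpace ℝ E]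
    {f : E → E} {K : NNReal} (hf : LipschitzWith K f) {t : ℝ} (ht : |t| * K < 1) :
    Function.Injective fun x => x + t • f x := by
  intro x y hxy
  have h1 : x - y = t • (f y - f x) := by
    rw [smul_sub, sub_eq_sub_iff_add_eq_add, add_comm (t • f y)]
    exact hxy
  have h2 : ‖x - y‖ ≤ |t| * K * ‖x - y‖ := by
    calc ‖x - y‖ = |t| * ‖f y - f x‖ := by
          conv_lhs => rw [h1, norm_smul, Real.norm_eq_abs]
      _ ≤ |t| * (K * ‖y - x‖) := by gcongr; exact hf.norm_sub_le y x
      _ = |t| * K * ‖x - y‖ := by rw [norm_sub_rev]; ring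
  by_contra hne
  have h3 : 0 < ‖x - y‖ := norm_pos_iff.2 (sub_ne_zero.2 hne)
  nlinarith

lemma Continuous.integrableOn_of_isBounded {E F : Type*} [NormedAddCommGroup E] [ProperSpace E]
    [MeasurableSpace E] [OpensMeasurableSpace E] [NormedAddCommGroup F]
    {μ : Measure E} [IsFiniteMeasureOnCompacts μ] {f : E → F} (hf : Continuous f)
    {s : Set E} (hs : Bornology.IsBounded s) : IntegrableOn f s μ :=
  (hf.continuousOn.integrableOn_compact hs.isCompact_closure).mono_set subset_closure

/-- Shape derivative of the gravitational term: `t ↦ ∫_{(Id+tU)(Ω)} x₃ dx` is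
differentiable at `0` with derivative `∫_Ω U_z + ∫_Ω x₃ · div U`. -/
theorem stmt_2 (Ω : Set (Fin 3 → ℝ)) (hΩb : Bornology.IsBounded Ω)
    (hΩm : MeasurableSet Ω)
    (U : (Fin 3 → ℝ) → (Fin 3 → ℝ)) (hU : ContDiff ℝ 1 U)
    (hUbdd : ∃ M : ℝ, ∀ x, ‖U x‖ ≤ M) (hDUbdd : ∃ M : ℝ, ∀ x, ‖fderiv ℝ U x‖ ≤ M) :
    HasDerivAt (fun t : ℝ => ∫ y in (fun x => x + t • U x) '' Ω, y 2)
      ((∫ x in Ω, U x 2) +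
        ∫ x in Ω, x 2 * LinearMap.trace ℝ (Fin 3 → ℝ) (fderiv ℝ U x).toLinearMap) 0 := by
  obtain ⟨M, hM⟩ := hDUbdd
  have hdiff : Differentiable ℝ U := hU.differentiable one_ne_zero
  have hD : Continuous (fderiv ℝ U) := hU.continuous_fderiv one_ne_zero
  have hU2 : Continuous fun x => U x 2 := (continuous_apply 2).comp hU.continuous
  have hx2 : Continuous fun x : Fin 3 → ℝ => x 2 := continuous_apply 2
  set T : (Fin 3 → ℝ) → ℝ :=
    fun x => LinearMap.trace ℝ (Fin 3 → ℝ) (fderiv ℝ U x).toLinearMap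
  set S : (Fin 3 → ℝ) → ℝ := fun x => (T x ^ 2 -
    LinearMap.trace ℝ (Fin 3 → ℝ) ((fderiv ℝ U x).comp (fderiv ℝ U x)).toLinearMap) / 2
  set D : (Fin 3 → ℝ) → ℝ := fun x => (fderiv ℝ U x).det
  have hT : Continuous T := continuous_trace_toLinearMap.comp hD
  have hS : Continuous S :=
    ((hT.pow 2).sub (continuous_trace_toLinearMap.comp (hD.clm_comp hD))).div_const 2
  have hDet : Continuous D := ContinuousLinearMap.continuous_det.comp hD
  have hdet : ∀ t x, (ContinuousLinearMap.id ℝ (Fin 3 → ℝ) + t • fderiv ℝ U x).det =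
      1 + t * T x + t ^ 2 * S x + t ^ 3 * D x := fun t x => det_one_add_smul_fin_three _ t
  have hlip : LipschitzWith M.toNNReal U :=
    lipschitzWith_of_nnnorm_fderiv_le hdiff fun x => by
      rw [← NNReal.coe_le_coe, coe_nnnorm]
      exact (hM x).trans (Real.le_coe_toNNReal M)
  have hinj : ∀ᶠ t : ℝ in 𝓝 0, Function.Injective fun x => x + t • U x := by
    have hc : Continuous fun t : ℝ => |t| * (M.toNNReal : ℝ) := by fun_prop
    filter_upwards [hc.continuousAt.eventually_lt_const (show |(0 : ℝ)| * _ < 1 by simp)]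
      with t ht using hlip.injective_add_smul ht
  have hpos : ∀ᶠ t : ℝ in 𝓝 0, ∀ x ∈ closure Ω, 0 < 1 + t * T x + t ^ 2 * S x + t ^ 3 * D x := by
    refine hΩb.isCompact_closure.eventually_forall_of_forall_eventually fun x _ => ?_
    have hc : Continuous fun p : ℝ × (Fin 3 → ℝ) =>
        1 + p.1 * T p.2 + p.1 ^ 2 * S p.2 + p.1 ^ 3 * D p.2 := by fun_prop
    exact hc.continuousAt.eventually_const_lt (by simp)
  have key : (fun t : ℝ => ∫ y in (fun x => x + t • U x) '' Ω, y 2) =ᶠ[𝓝 0] fun t =>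
      (∫ x in Ω, x 2) + t * (∫ x in Ω, U x 2 + x 2 * T x) +
      t ^ 2 * (∫ x in Ω, (T x * U x 2 + S x * x 2) + t * (S x * U x 2 + D x * x 2) +
        t ^ 2 * (D x * U x 2)) := by
    filter_upwards [hinj, hpos] with t ht hp
    have hderiv : ∀ x ∈ Ω, HasFDerivWithinAt (fun x => x + t • U x)
        (ContinuousLinearMap.id ℝ (Fin 3 → ℝ) + t • fderiv ℝ U x) Ω x := fun x _ =>
      ((hasFDerivAt_id x).add ((hdiff x).hasFDerivAt.const_smul t)).hasFDerivWithinAt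
    rw [integral_image_eq_integral_abs_det_fderiv_smul volume hΩm hderiv ht.injOn]
    rw [← integral_const_mul, ← integral_const_mul, ← integral_add, ← integral_add]
    · refine setIntegral_congr_fun hΩm fun x hx => ?_
      simp only [hdet, abs_of_pos (hp x (subset_closure hx)), smul_eq_mul, Pi.add_apply,
        Pi.smul_apply]
      ring
    all_goals exact Continuous.integrableOn_of_isBounded (by fun_prop) hΩb
  have hrem : (fun t : ℝ => ∫ x in Ω, (T x * U x 2 + S x * x 2) +
      t * (S x * U x 2 + D x * x 2) + t ^ 2 * (D x * U x 2)) = fun t =>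
      (∫ x in Ω, T x * U x 2 + S x * x 2) + t * (∫ x in Ω, S x * U x 2 + D x * x 2) +
        t ^ 2 * ∫ x in Ω, D x * U x 2 := by
    funext t
    rw [← integral_const_mul, ← integral_const_mul, ← integral_add, ← integral_add]
    all_goals exact Continuous.integrableOn_of_isBounded (by fun_prop) hΩb
  refine HasDerivAt.congr_of_eventuallyEq ?_ key
  have hsum : (∫ x in Ω, U x 2) + ∫ x in Ω, x 2 * T x = ∫ x in Ω, U x 2 + x 2 * T x :=
    (integral_add (hU2.integrableOn_of_isBounded hΩb)
      ((hx2.mul hT).integrableOn_of_isBounded hΩb)).symm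
  rw [hsum]
  have hdrem : DifferentiableAt ℝ (fun t : ℝ => ∫ x in Ω, (T x * U x 2 + S x * x 2) +
      t * (S x * U x 2 + D x * x 2) + t ^ 2 * (D x * U x 2)) 0 := by
    rw [hrem]
    fun_prop
  convert! (((hasDerivAt_id (0 : ℝ)).mul_const (∫ x in Ω, U x 2 + x 2 * T x)).const_add
    (∫ x in Ω, x 2)).add (((hasDerivAt_id (0 : ℝ)).pow 2).mul hdrem.hasDerivAt) using 1
  simp
end

section
/- For a real number a > 0 and an integer p ≥ 1, define u_p : ℝ² → ℝ by u_p(r,z) = exp(1/(p²((r−a)²+z²) − 1)) if (r−a)²+z² < 1/p², and u_p(r,z) = 0 otherwise; u_p is C¹ and supported in the closed ball B_p of center A = (a,0) and radius 1/p. Then for every Lebesgue-measurable set ω ⊆ ℝ², the integrals I_p = ∫_ω z·(2 u_p(r,z) + r·(∂u_p/∂r)(r,z)) dr dz satisfy lim_{p→∞} I_p = 0. -/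
open MeasureTheory Filter

/-- The bump deformation `u_p(r,z) = exp(1/(p²((r−a)²+z²) − 1))` on the open ball of
center `(a,0)` and radius `1/p`, extended by `0`. -/
noncomputable def up (a : ℝ) (p : ℕ) : ℝ × ℝ → ℝ := fun x =>
  if (x.1 - a) ^ 2 + x.2 ^ 2 < 1 / (p : ℝ) ^ 2 then
    Real.exp (1 / ((p : ℝ) ^ 2 * ((x.1 - a) ^ 2 + x.2 ^ 2) - 1))
  else 0

theorem up_eq_expNegInvGlue (a : ℝ) {p : ℕ} (hp : 0 < p) :
    up a p = fun x => expNegInvGlue (1 - (p : ℝ) ^ 2 * ((x.1 - a) ^ 2 + x.2 ^ 2)) := by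
  funext x
  have hp' : (0 : ℝ) < (p : ℝ) ^ 2 := by positivity
  simp only [up, expNegInvGlue, lt_div_iff₀' hp']
  split_ifs with h1 h2 h2
  · linarith
  · rw [← inv_neg, neg_sub, one_div]
  · rfl
  · linarith

theorem deriv_expNegInvGlue_of_nonpos {t : ℝ} (ht : t ≤ 0) : deriv expNegInvGlue t = 0 :=
  IsLocalMin.deriv_eq_zero <| Eventually.of_forall fun s => by
    simpa [expNegInvGlue.zero_of_nonpos ht] using expNegInvGlue.nonneg s

theorem expNegInvGlue_le_one (t : ℝ) : expNegInvGlue t ≤ 1 := by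
  unfold expNegInvGlue
  split_ifs with h
  · exact zero_le_one
  · exact Real.exp_le_one_iff.2 (by have := not_le.1 h; simp [this.le])

theorem fderiv_up_apply (a : ℝ) {p : ℕ} (hp : 0 < p) (x : ℝ × ℝ) :
    fderiv ℝ (up a p) x (1, 0) =
      deriv expNegInvGlue (1 - (p : ℝ) ^ 2 * ((x.1 - a) ^ 2 + x.2 ^ 2)) *
        (-(2 * (p : ℝ) ^ 2 * (x.1 - a))) := by
  have hd : Differentiable ℝ expNegInvGlue :=
    (expNegInvGlue.contDiff (n := 1)).differentiable one_ne_zero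
  have hu : DifferentiableAt ℝ (up a p) x := by
    rw [up_eq_expNegInvGlue a hp]
    exact hd.differentiableAt.comp x (by fun_prop)
  have hline : HasDerivAt (fun s : ℝ => ((s, x.2) : ℝ × ℝ)) (1, 0) x.1 :=
    (hasDerivAt_id x.1).prodMk (hasDerivAt_const x.1 x.2)
  have h1 : HasDerivAt (fun s : ℝ => up a p (s, x.2)) (fderiv ℝ (up a p) x (1, 0)) x.1 :=
    HasFDerivAt.comp_hasDerivAt (f := fun s : ℝ => ((s, x.2) : ℝ × ℝ)) x.1 hu.hasFDerivAt hline
  refine h1.unique ?_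
  simp only [up_eq_expNegInvGlue a hp]
  refine HasDerivAt.comp x.1 (h₂ := expNegInvGlue)
    (h := fun s : ℝ => 1 - (p : ℝ) ^ 2 * ((s - a) ^ 2 + x.2 ^ 2)) hd.differentiableAt.hasDerivAt ?_
  have h2 := (((((hasDerivAt_id x.1).sub_const a).pow 2).add_const (x.2 ^ 2)).const_mul
    ((p : ℝ) ^ 2)).const_sub 1
  exact HasDerivAt.congr_deriv h2 (by norm_num; ring)

theorem exists_norm_deriv_expNegInvGlue_le :
    ∃ C : ℝ, 0 ≤ C ∧ ∀ t ≤ 1, |deriv expNegInvGlue t| ≤ C := by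
  have hc : Continuous (deriv expNegInvGlue) :=
    (expNegInvGlue.contDiff (n := 1)).continuous_deriv le_rfl
  obtain ⟨C, hC⟩ := (isCompact_Icc (a := (0 : ℝ)) (b := 1)).exists_bound_of_continuousOn
    hc.continuousOn
  have hC0 : 0 ≤ C := (norm_nonneg _).trans (hC 0 (by simp))
  refine ⟨C, hC0, fun t ht => ?_⟩
  rcases le_total t 0 with h | h
  · simpa [deriv_expNegInvGlue_of_nonpos h] using hC0
  · exact hC t ⟨h, ht⟩

theorem integrand_eq_zero (a : ℝ) {p : ℕ} (hp : 0 < p) {x : ℝ × ℝ}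
    (hx : x ∉ Metric.closedBall ((a, 0) : ℝ × ℝ) (1 / p)) :
    x.2 * (2 * up a p x + x.1 * fderiv ℝ (up a p) x (1, 0)) = 0 := by
  have hp' : (0 : ℝ) < p := by positivity
  have ht : 1 - (p : ℝ) ^ 2 * ((x.1 - a) ^ 2 + x.2 ^ 2) ≤ 0 := by
    by_contra! h
    have key : ∀ y : ℝ, (p * y) ^ 2 ≤ 1 → |y| ≤ 1 / p := fun y hy => by
      have h1 := (sq_le_one_iff_abs_le_one _).1 hy
      rwa [abs_mul, abs_of_pos hp', ← le_div_iff₀' hp'] at h1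
    refine hx ?_
    rw [Metric.mem_closedBall, Prod.dist_eq, max_le_iff, Real.dist_eq, Real.dist_eq, sub_zero]
    constructor
    · exact key _ (by nlinarith [sq_nonneg (p * x.2)])
    · exact key _ (by nlinarith [sq_nonneg (p * (x.1 - a))])
  rw [fderiv_up_apply a hp, deriv_expNegInvGlue_of_nonpos ht, up_eq_expNegInvGlue a hp]
  simp [expNegInvGlue.zero_of_nonpos ht]

theorem norm_integrand_le {a C : ℝ} (ha : 0 < a) (hC0 : 0 ≤ C)
    (hC : ∀ t ≤ 1, |deriv expNegInvGlue t| ≤ C) {p : ℕ} (hp : 0 < p) {x : ℝ × ℝ}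
    (hx : x ∈ Metric.closedBall ((a, 0) : ℝ × ℝ) (1 / p)) :
    ‖x.2 * (2 * up a p x + x.1 * fderiv ℝ (up a p) x (1, 0))‖ ≤ 2 + (a + 1) * (C * 2) := by
  have hp1 : (1 : ℝ) ≤ p := by exact_mod_cast hp
  have hp' : (0 : ℝ) < p := by positivity
  have hinv : 1 / (p : ℝ) ≤ 1 := by rw [div_le_one hp']; exact hp1
  rw [Metric.mem_closedBall, Prod.dist_eq, max_le_iff, Real.dist_eq, Real.dist_eq, sub_zero] at hx
  obtain ⟨hr, hz⟩ := hx
  have hu : |up a p x| ≤ 1 := by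
    rw [up_eq_expNegInvGlue a hp, abs_of_nonneg (expNegInvGlue.nonneg _)]
    exact expNegInvGlue_le_one _
  have hr' : |x.1| ≤ a + 1 := by
    have := abs_sub_abs_le_abs_sub x.1 a
    rw [abs_of_pos ha] at this
    linarith
  have hf : |fderiv ℝ (up a p) x (1, 0)| ≤ C * (2 * p) := by
    rw [fderiv_up_apply a hp, abs_mul, abs_neg, abs_mul, abs_of_pos (by positivity :
      (0 : ℝ) < 2 * (p : ℝ) ^ 2)]
    refine mul_le_mul (hC _ (sub_le_self _ (by positivity))) ?_ (by positivity) hC0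
    calc 2 * (p : ℝ) ^ 2 * |x.1 - a| ≤ 2 * (p : ℝ) ^ 2 * (1 / p : ℝ) := by gcongr
      _ = 2 * (p : ℝ) := by field_simp
  rw [Real.norm_eq_abs, abs_mul]
  calc |x.2| * |2 * up a p x + x.1 * fderiv ℝ (up a p) x (1, 0)|
      ≤ 1 / p * (2 * 1 + (a + 1) * (C * (2 * p))) := by
        refine mul_le_mul hz ?_ (abs_nonneg _) (by positivity)
        refine (abs_add_le _ _).trans ?_
        rw [abs_mul, abs_mul, abs_two]
        gcongr
    _ = 1 / p * 2 + (a + 1) * (C * 2) := by field_simp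
    _ ≤ 2 + (a + 1) * (C * 2) := by linarith

/-- Limit (grav_3): `∫_ω z·(2u_p + r·∂u_p/∂r) dr dz → 0` as `p → ∞`. -/
theorem stmt_9 (a : ℝ) (ha : 0 < a) (ω : Set (ℝ × ℝ)) (hω : MeasurableSet ω) :
    Tendsto (fun p : ℕ =>
        ∫ x in ω, x.2 * (2 * up a p x + x.1 * fderiv ℝ (up a p) x (1, 0)))
      atTop (nhds 0) := by
  obtain ⟨C, hC0, hC⟩ := exists_norm_deriv_expNegInvGlue_le
  set K : ℝ := 2 + (a + 1) * (C * 2)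
  have hlim : Tendsto (fun p : ℕ => K * ((1 / (p : ℝ)) ^ 2 *
      volume.real (Metric.closedBall (0 : ℝ × ℝ) 1))) atTop (nhds 0) := by
    simpa using ((tendsto_one_div_atTop_nhds_zero_nat (𝕜 := ℝ)).pow 2
      |>.mul_const (volume.real (Metric.closedBall (0 : ℝ × ℝ) 1))).const_mul K
  refine squeeze_zero_norm' ?_ hlim
  filter_upwards [eventually_gt_atTop 0] with p hp
  set B := Metric.closedBall ((a, 0) : ℝ × ℝ) (1 / p)
  have hB : volume B < ⊤ := measure_closedBall_lt_top
  have hvol : volume.real B = (1 / (p : ℝ)) ^ 2 *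
      volume.real (Metric.closedBall (0 : ℝ × ℝ) 1) := by
    have := Measure.addHaar_real_closedBall' (volume : Measure (ℝ × ℝ)) (a, 0)
      (by positivity : (0 : ℝ) ≤ 1 / p)
    simpa [B] using this
  have hzero := setIntegral_eq_of_subset_of_forall_sdiff_eq_zero (μ := volume) hω
    (Set.inter_subset_left (t := B))
    fun x hx => integrand_eq_zero a hp fun h => hx.2 ⟨hx.1, h⟩
  rw [hzero, ← hvol]
  refine (norm_setIntegral_le_of_norm_le_const
    ((measure_mono Set.inter_subset_right).trans_lt hB)
    fun x hx => norm_integrand_le ha hC0 hC hp hx.2).trans ?_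
  exact mul_le_mul_of_nonneg_left (measureReal_mono Set.inter_subset_right hB.ne) (by positivity)
end

section
/- For a real number a > 0 and an integer p ≥ 1, define u_p : ℝ² → ℝ by u_p(r,z) = exp(1/(p²((r−a)²+z²) − 1)) if (r−a)²+z² < 1/p², and u_p(r,z) = 0 otherwise; u_p is C¹ and supported in the closed ball B_p of center A = (a,0) and radius 1/p. Then for every Lebesgue-measurable set ω ⊆ ℝ², the integrals J_p = ∫_ω (u_p(r,z) + r·(∂u_p/∂r)(r,z)) dr dz satisfy lim_{p→∞} J_p = 0. -/
open MeasureTheory Filter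

/-- The bump function `exp(1/(|y|² − 1))` on the open Euclidean unit disc, extended by `0`. -/
noncomputable def unitBump (y : ℝ × ℝ) : ℝ := expNegInvGlue (1 - (y.1 ^ 2 + y.2 ^ 2))

theorem contDiff_unitBump : ContDiff ℝ 1 unitBump :=
  expNegInvGlue.contDiff.comp (by fun_prop)

theorem tsupport_unitBump_subset : tsupport unitBump ⊆ Metric.closedBall 0 1 := by
  refine closure_minimal (fun y hy => ?_) Metric.isClosed_closedBall
  have h : ¬ 1 - (y.1 ^ 2 + y.2 ^ 2) ≤ 0 := fun h => hy (expNegInvGlue.zero_of_nonpos h)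
  rw [mem_closedBall_zero_iff, Prod.norm_def, Real.norm_eq_abs, Real.norm_eq_abs, max_le_iff]
  constructor <;> apply abs_le_one_iff_mul_self_le_one.2 <;> nlinarith [sq_nonneg y.1, sq_nonneg y.2]

theorem hasCompactSupport_unitBump : HasCompactSupport unitBump :=
  (isCompact_closedBall _ _).of_isClosed_subset (isClosed_tsupport _) tsupport_unitBump_subset

theorem up_eq_unitBump (a : ℝ) {p : ℕ} (hp : 0 < p) :
    up a p = fun x => unitBump ((p : ℝ) • (x - (a, 0))) := by
  have hp' : (0 : ℝ) < (p : ℝ) ^ 2 := by positivity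
  funext x
  have hs : 1 - (((p : ℝ) • (x - (a, 0))).1 ^ 2 + ((p : ℝ) • (x - (a, 0))).2 ^ 2) =
      -((p : ℝ) ^ 2 * ((x.1 - a) ^ 2 + x.2 ^ 2) - 1) := by
    simp only [Prod.smul_fst, Prod.smul_snd, Prod.fst_sub, Prod.snd_sub, smul_eq_mul]
    ring
  rw [up, unitBump, hs, expNegInvGlue]
  by_cases h : (x.1 - a) ^ 2 + x.2 ^ 2 < 1 / (p : ℝ) ^ 2
  · rw [if_pos h, if_neg, inv_neg, neg_neg, one_div]
    rw [lt_div_iff₀ hp'] at h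
    linarith
  · rw [if_neg h, if_pos]
    rw [lt_div_iff₀ hp'] at h
    linarith

theorem fderiv_up (a : ℝ) {p : ℕ} (hp : 0 < p) (x : ℝ × ℝ) :
    fderiv ℝ (up a p) x = (p : ℝ) • fderiv ℝ unitBump ((p : ℝ) • (x - (a, 0))) := by
  have hg : HasFDerivAt (fun x : ℝ × ℝ => (p : ℝ) • (x - (a, 0)))
      ((p : ℝ) • ContinuousLinearMap.id ℝ (ℝ × ℝ)) x :=
    ((hasFDerivAt_id x).sub_const (a, 0)).const_smul (p : ℝ)
  have hG := (contDiff_unitBump.differentiable one_ne_zero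
    ((p : ℝ) • (x - (a, 0)))).hasFDerivAt.comp x hg
  rw [up_eq_unitBump a hp]
  refine hG.fderiv.trans ?_
  ext <;> simp

theorem exists_norm_setIntegral_up_le (a : ℝ) {ω : Set (ℝ × ℝ)} (hω : MeasurableSet ω) :
    ∃ C D : ℝ, ∀ p : ℕ, 0 < p →
      ‖∫ x in ω, up a p x + x.1 * fderiv ℝ (up a p) x (1, 0)‖ ≤
        (C + (|a| + 1) * (p * D)) * (2 / p) ^ 2 := by
  obtain ⟨C, hC⟩ := hasCompactSupport_unitBump.exists_bound_of_continuous
    contDiff_unitBump.continuous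
  obtain ⟨D, hD⟩ := (hasCompactSupport_unitBump.fderiv ℝ).exists_bound_of_continuous
    (contDiff_unitBump.continuous_fderiv one_ne_zero)
  refine ⟨C, D, fun p hp => ?_⟩
  have hp0 : (0 : ℝ) < p := by exact_mod_cast hp
  have hC0 : 0 ≤ C := (norm_nonneg _).trans (hC 0)
  have hD0 : 0 ≤ D := (norm_nonneg _).trans (hD 0)
  set B : Set (ℝ × ℝ) := Metric.closedBall (a, 0) (1 / p) with hB
  have hmem (x : ℝ × ℝ) : x ∈ B ↔ (p : ℝ) • (x - (a, 0)) ∈ Metric.closedBall (0 : ℝ × ℝ) 1 := by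
    rw [hB, mem_closedBall_iff_norm, mem_closedBall_zero_iff, norm_smul, Real.norm_natCast,
      le_div_iff₀' hp0]
  have hBvol : volume B = ENNReal.ofReal ((2 / p) ^ 2) := by
    rw [hB, ← closedBall_prod_same, Measure.volume_eq_prod, Measure.prod_prod,
      Real.volume_closedBall, Real.volume_closedBall, ← ENNReal.ofReal_mul (by positivity)]
    congr 1
    ring
  have hBreal : volume.real B = (2 / p) ^ 2 := by
    rw [Measure.real, hBvol, ENNReal.toReal_ofReal (by positivity)]
  have hBfin : volume B < ⊤ := hBvol ▸ ENNReal.ofReal_lt_top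
  have hzero : ∀ x ∈ ω \ (ω ∩ B), up a p x + x.1 * fderiv ℝ (up a p) x (1, 0) = 0 := by
    intro x hx
    have hx' : (p : ℝ) • (x - (a, 0)) ∉ tsupport unitBump := fun h =>
      hx.2 ⟨hx.1, (hmem x).2 (tsupport_unitBump_subset h)⟩
    have h0 : fderiv ℝ unitBump ((p : ℝ) • (x - (a, 0))) = 0 :=
      Function.notMem_support.1 fun h => hx' (support_fderiv_subset ℝ h)
    rw [fderiv_up a hp, h0, up_eq_unitBump a hp]
    simp [image_eq_zero_of_notMem_tsupport hx']
  rw [setIntegral_eq_of_subset_of_forall_sdiff_eq_zero hω Set.inter_subset_left hzero]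
  have hbound : ∀ x ∈ ω ∩ B, ‖up a p x + x.1 * fderiv ℝ (up a p) x (1, 0)‖ ≤
      C + (|a| + 1) * (p * D) := by
    intro x hx
    have hx1 : |x.1| ≤ |a| + 1 := by
      have h1 : ‖x - (a, 0)‖ ≤ 1 / p := mem_closedBall_iff_norm.1 hx.2
      have h2 : |x.1 - a| ≤ ‖x - (a, 0)‖ := norm_fst_le (x - (a, 0))
      have h3 : 1 / (p : ℝ) ≤ 1 := (div_le_one hp0).2 (by exact_mod_cast hp)
      linarith [abs_sub_abs_le_abs_sub x.1 a]
    have hup : ‖up a p x‖ ≤ C := by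
      rw [up_eq_unitBump a hp]
      exact hC _
    have hone : ‖((1 : ℝ), (0 : ℝ))‖ = 1 := by simp [Prod.norm_def]
    have hder : ‖fderiv ℝ (up a p) x (1, 0)‖ ≤ p * D := by
      refine (ContinuousLinearMap.le_opNorm _ _).trans ?_
      rw [hone, mul_one, fderiv_up a hp, norm_smul, Real.norm_natCast]
      exact mul_le_mul_of_nonneg_left (hD _) hp0.le
    refine (norm_add_le _ _).trans (add_le_add hup ?_)
    rw [norm_mul]
    exact mul_le_mul hx1 hder (norm_nonneg _) (by positivity)
  refine (norm_setIntegral_le_of_norm_le_const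
    ((measure_mono Set.inter_subset_right).trans_lt hBfin) hbound).trans ?_
  rw [← hBreal]
  exact mul_le_mul_of_nonneg_left (measureReal_mono Set.inter_subset_right hBfin.ne)
    (by positivity)

/-- Limit (lcont): `∫_ω (u_p + r·∂u_p/∂r) dr dz → 0` as `p → ∞`. -/
theorem stmt_10 (a : ℝ) (ha : 0 < a) (ω : Set (ℝ × ℝ)) (hω : MeasurableSet ω) :
    Tendsto (fun p : ℕ =>
        ∫ x in ω, up a p x + x.1 * fderiv ℝ (up a p) x (1, 0))
      atTop (nhds 0) := by
  obtain ⟨C, D, h⟩ := exists_norm_setIntegral_up_le a hω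
  refine squeeze_zero_norm' (a := fun p : ℕ =>
    C * (2 / (p : ℝ)) ^ 2 + (|a| + 1) * D * 2 * (2 / (p : ℝ))) ?_ ?_
  · filter_upwards [eventually_gt_atTop 0] with p hp
    have hp0 : (p : ℝ) ≠ 0 := by exact_mod_cast hp.ne'
    refine (h p hp).trans_eq ?_
    field_simp
  · have ht := tendsto_const_div_atTop_nhds_zero_nat (2 : ℝ)
    simpa using ((ht.pow 2).const_mul C).add (ht.const_mul ((|a| + 1) * D * 2))
end

section
/- Let ε_S > 0, ε_G > 0 and Θ ∈ (0, π) be real numbers. If λ ∈ (0, 1) satisfies ε_S·tan(λ(π − Θ)) = −ε_G·tan(λπ), then λ > 1/2 (here tan denotes the real tangent function, with the convention tan(π/2) = 0 at its singularity). -/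
open Real

/-- The singular exponent `λ ∈ (0,1)` solving `ε_S tan(λ(π−Θ)) = −ε_G tan(λπ)`
(with the contact angle `Θ ∈ (0,π)` and positive permittivities) satisfies `λ > 1/2`. -/
theorem stmt_19 (εS εG Θ lam : ℝ) (hS : 0 < εS) (hG : 0 < εG)
    (hΘ : Θ ∈ Set.Ioo 0 π) (hlam : lam ∈ Set.Ioo (0 : ℝ) 1)
    (heq : εS * Real.tan (lam * (π - Θ)) = -εG * Real.tan (lam * π)) :
    1 / 2 < lam := by
  obtain ⟨hΘ0, hΘπ⟩ := hΘ
  by_contra! hle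
  have hleft : 0 < tan (lam * (π - Θ)) :=
    tan_pos_of_pos_of_lt_pi_div_two (mul_pos hlam.1 (sub_pos.2 hΘπ))
      (by nlinarith [mul_pos hlam.1 hΘ0, pi_pos])
  have hright : 0 ≤ tan (lam * π) :=
    tan_nonneg_of_nonneg_of_le_pi_div_two (mul_pos hlam.1 pi_pos).le (by nlinarith [pi_pos])
  linarith [mul_pos hS hleft, mul_nonneg hG.le hright]
end
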